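/- Let ω be an n-core and φ_n(ω) = (m_0,…,m_{n−1}) its n-charge. Then ω belongs to 𝒞_n^{dd} := 𝒞_n ∩ 𝒟𝒟 (the set of doubled distinct n-cores) if and only if m_0 = 0 and m_{n−i} = −m_i for all i ∈ {1,…,⌊(n−1)/2⌋}. Moreover the map from 𝒞_n^{dd} to ℤ^{⌊(n−1)/2⌋} sending ω to (m_1,…,m_{⌊(n−1)/2⌋}) is a bijection, and |ω| = n Σ_{i=1}^{⌊(n−1)/2⌋} m_i² + Σ_{i=1}^{⌊(n−1)/2⌋} (2i − n) m_i. -/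

import Mathlib

open scoped Classical

/-- `p k` is the `(k+1)`-st part `λ_{k+1}` of the partition `λ` :
partitions are encoded by their (eventually zero, antitone) sequence of parts. -/
def IsPartition (p : ℕ → ℕ) : Prop :=
  Antitone p ∧ ∃ N, ∀ i, N ≤ i → p i = 0

/-- The number of (nonzero) parts of a partition. -/
noncomputable def plen (p : ℕ → ℕ) : ℕ := Nat.card {i : ℕ // p i ≠ 0}

/-- The number of boxes `|λ|` of a partition. -/
noncomputable def psize (p : ℕ → ℕ) : ℕ := ∑ i ∈ Finset.range (plen p), p i

/-- The conjugate partition : `pconj p j = λ^tr_{j+1}`. -/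
noncomputable def pconj (p : ℕ → ℕ) (j : ℕ) : ℕ := Nat.card {i : ℕ // j + 1 ≤ p i}

/-- The size of the Durfee square of a partition. -/
noncomputable def durfee (p : ℕ → ℕ) : ℕ := Nat.card {i : ℕ // i + 1 ≤ p i}

/-- The cells (boxes) of the Young diagram, `0`-indexed : `(i, j)` is the box in
row `i+1` and column `j+1`. -/
noncomputable def cells (p : ℕ → ℕ) : Finset (ℕ × ℕ) :=
  (Finset.range (plen p) ×ˢ Finset.range (p 0)).filter fun s => s.2 < p s.1

/-- The hook length of the (0-indexed) box `(i, j)` :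
`h = λ_{i+1} - (j+1) + λ^tr_{j+1} - (i+1) + 1`. -/
noncomputable def hookLen (p : ℕ → ℕ) (i j : ℕ) : ℕ :=
  (p i - j) + (pconj p j - i) - 1

/-- The multiset of hook lengths `ℋ(λ)`. -/
noncomputable def hooks (p : ℕ → ℕ) : Multiset ℕ :=
  (cells p).val.map fun s => hookLen p s.1 s.2

/-- The multiset of hook lengths of the boxes strictly above the main diagonal. -/
noncomputable def hooksAbove (p : ℕ → ℕ) : Multiset ℕ :=
  ((cells p).filter fun s => s.1 < s.2).val.map fun s => hookLen p s.1 s.2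

/-- The multiset of hook lengths of the boxes strictly below the main diagonal. -/
noncomputable def hooksBelow (p : ℕ → ℕ) : Multiset ℕ :=
  ((cells p).filter fun s => s.2 < s.1).val.map fun s => hookLen p s.1 s.2

/-- `p` is an `n`-core : no hook length is equal to `n`. -/
def IsCore (n : ℕ) (p : ℕ → ℕ) : Prop := n ∉ hooks p

/-- Self-conjugate partitions. -/
def SelfConj (p : ℕ → ℕ) : Prop := p = pconj p

/-- Distinct partitions (strictly decreasing nonzero parts). -/
def IsDistinct (p : ℕ → ℕ) : Prop := ∀ i, p (i + 1) ≠ 0 → p (i + 1) < p i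

/-- Doubled distinct partitions : `λ_i = λ^tr_i + 1` for `i` at most
the size of the Durfee square. -/
def IsDD (p : ℕ → ℕ) : Prop := ∀ i < durfee p, p i = pconj p i + 1

/-- Conjugates of doubled distinct partitions. -/
def IsDDtr (p : ℕ → ℕ) : Prop := ∃ q, IsPartition q ∧ IsDD q ∧ p = pconj q

/-- The doubled distinct partition `λ̄λ̄` of a distinct partition `λ̄` :
add `λ̄_i` boxes to the `i`-th column of the shifted Young diagram of `λ̄`. -/
noncomputable def double (b : ℕ → ℕ) : ℕ → ℕ := fun i =>
  if i < plen b then b i + (i + 1)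
  else Nat.card {j : ℕ // j < plen b ∧ i + 1 ≤ b j + j}

/-- The self-conjugate partition associated with a distinct partition `λ̄` :
add `λ̄_i - 1` boxes to the `i`-th column of the shifted Young diagram of `λ̄`. -/
noncomputable def scOf (b : ℕ → ℕ) : ℕ → ℕ := fun i =>
  if i < plen b then b i + i
  else Nat.card {j : ℕ // j < plen b ∧ i + 1 ≤ b j + j}

/-- The binary word `ψ(λ) = (c_k)_{k ∈ ℤ}` of a partition :
`c_k = 0` iff `k ∈ {λ_i - i : i ≥ 1}` and `c_k = 1` otherwise
(i.e. iff `k ∈ {j - λ^tr_j - 1 : j ≥ 1}`). -/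
noncomputable def word (p : ℕ → ℕ) (k : ℤ) : ℕ :=
  if ∃ m : ℕ, k = (p m : ℤ) - ((m : ℤ) + 1) then 0 else 1

/-- The `g`-charge of a `g`-core : `m_i = min {k ∈ ℤ : c_{kg+i} = 1}`. -/
noncomputable def ncharge (g : ℕ) (p : ℕ → ℕ) (i : ℕ) : ℤ :=
  sInf {k : ℤ | word p (k * (g : ℤ) + (i : ℤ)) = 1}

/-- The subword of residue `k` modulo `g` of the word of `p`. -/
noncomputable def subword (g k : ℕ) (p : ℕ → ℕ) (i : ℤ) : ℕ :=
  word p ((g : ℤ) * i + (k : ℤ))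

/-- The shift turning the subword of residue `k` into a balanced partition word. -/
noncomputable def qcharge (g : ℕ) (p : ℕ → ℕ) (k : ℕ) : ℤ :=
  (Nat.card {i : ℕ // subword g k p (i : ℤ) = 0} : ℤ) -
    (Nat.card {i : ℕ // subword g k p (-((i : ℤ) + 1)) = 1} : ℤ)

/-- `ν` is the `k`-th component of the `g`-quotient of `p` : its word is the
subword of residue `k` of the word of `p`, reindexed so as to be balanced. -/
def IsQuotientAt (g : ℕ) (p : ℕ → ℕ) (k : ℕ) (ν : ℕ → ℕ) : Prop :=
  ∀ i : ℤ, word ν i = subword g k p (i + qcharge g p k)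

/-- `ω` is the `g`-core of `p` : every subword of its word is sorted
(all `0`'s, then all `1`'s), with transition index the charge of `p`. -/
def IsCoreOf (g : ℕ) (p ω : ℕ → ℕ) : Prop :=
  ∀ k < g, ∀ i : ℤ, (subword g k ω i = 1 ↔ qcharge g p k ≤ i)

/-- `(ω, ν)` is the Littlewood decomposition of `p` for the modulus `g`. -/
def IsLittlewood (g : ℕ) (p ω : ℕ → ℕ) (ν : ℕ → ℕ → ℕ) : Prop :=
  IsCoreOf g p ω ∧ ∀ k < g, IsQuotientAt g p k (ν k)

/-- The number `a_r` of boxes of residue `r` modulo `g`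
(the residue of the box `(i, j)` -- `0`-indexed -- being `(j - i) mod g`). -/
noncomputable def resCount (g : ℕ) (p : ℕ → ℕ) (r : ℕ) : ℕ :=
  ((cells p).filter fun s => ((s.2 : ℤ) - (s.1 : ℤ)) % (g : ℤ) = (r : ℤ)).card

/-- The rectangular partition with `r` rows of length `c`. -/
def rect (r c : ℕ) : ℕ → ℕ := fun i => if i < r then c else 0

/-- The statistic `m = max({1} ∪ {(g + λ̄_i)/g : λ̄_i ≡ 0 (mod g)})`. -/
noncomputable def mStat (g : ℕ) (b : ℕ → ℕ) : ℕ :=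
  sSup ({1} ∪ {k : ℕ | ∃ i < plen b, g ∣ b i ∧ k = (g + b i) / g})

/-- The statistic `m' = max({0} ∪ {λ̄_i/g : λ̄_i ≡ g/2 (mod g)})`. -/
noncomputable def mStat' (g : ℕ) (b : ℕ → ℕ) : ℕ :=
  sSup ({0} ∪ {k : ℕ | ∃ i < plen b, 2 * (b i % g) = g ∧ k = b i / g})

/-- The bead positions `λ_i - i` of a partition: the positions of the zeros of its word. -/
def beads (p : ℕ → ℕ) : Set ℤ := Set.range fun m : ℕ => (p m : ℤ) - ((m : ℤ) + 1)

theorem word_eq_one_iff (p : ℕ → ℕ) (k : ℤ) : word p k = 1 ↔ k ∉ beads p := by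
  unfold word beads
  have hiff : (∃ m : ℕ, k = (p m : ℤ) - ((m : ℤ) + 1)) ↔
      k ∈ Set.range fun m : ℕ => (p m : ℤ) - ((m : ℤ) + 1) :=
    exists_congr fun _ => eq_comm
  rw [← hiff]
  split_ifs with h <;> simp [h]

theorem lt_card_iff {P : ℕ → Prop} (hP : ∀ i j, i ≤ j → P j → P i) (hN : ∃ N, ¬ P N) (i : ℕ) :
    i < Nat.card {i : ℕ // P i} ↔ P i := by
  obtain ⟨K, hK⟩ : ∃ K, ∀ i, P i ↔ i < K :=
    ⟨Nat.find hN, fun i => ⟨fun h => by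
      by_contra h'
      exact Nat.find_spec hN (hP _ _ (not_lt.1 h') h),
    fun h => not_not.1 (Nat.find_min hN h)⟩⟩
  obtain rfl : P = (· < K) := funext fun i => propext (hK i)
  rw [Nat.card_congr Fin.equivSubtype.symm, Nat.card_fin]

namespace IsPartition

variable {p : ℕ → ℕ}

theorem lt_pconj_iff (hp : IsPartition p) (i j : ℕ) : i < pconj p j ↔ j < p i := by
  obtain ⟨ha, N, hN⟩ := hp
  exact lt_card_iff (P := fun i => j + 1 ≤ p i) (fun a b hab h => h.trans (ha hab))
    ⟨N, by simp [hN N le_rfl]⟩ i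

theorem lt_durfee_iff (hp : IsPartition p) (i : ℕ) : i < durfee p ↔ i < p i := by
  obtain ⟨ha, N, hN⟩ := hp
  exact lt_card_iff (P := fun i => i + 1 ≤ p i)
    (fun a b hab h => by have := ha hab; omega) ⟨N, by simp [hN N le_rfl]⟩ i

theorem lt_plen_iff (hp : IsPartition p) (i : ℕ) : i < plen p ↔ p i ≠ 0 := by
  obtain ⟨ha, N, hN⟩ := hp
  exact lt_card_iff (P := fun i => p i ≠ 0)
    (fun a b hab h => by have := ha hab; omega) ⟨N, by simp [hN N le_rfl]⟩ i

theorem strictAnti_bead (hp : IsPartition p) :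
    StrictAnti fun m : ℕ => (p m : ℤ) - ((m : ℤ) + 1) := by
  intro a b hab
  have := hp.1 hab.le
  dsimp only
  omega

theorem not_mem_beads_iff (hp : IsPartition p) (x : ℤ) :
    x ∉ beads p ↔ ∃ j : ℕ, x = (j : ℤ) - pconj p j := by
  constructor
  · intro hx
    obtain ⟨N, hN⟩ := hp.2
    have hex : ∃ r : ℕ, (p r : ℤ) - ((r : ℤ) + 1) < x :=
      ⟨N + x.natAbs, by rw [hN _ (by omega)]; omega⟩
    set r := Nat.find hex with hr
    have hr1 : (p r : ℤ) - ((r : ℤ) + 1) < x := Nat.find_spec hex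
    obtain ⟨j, hj⟩ : ∃ j : ℕ, (j : ℤ) = x + r := ⟨(x + r).toNat, by omega⟩
    have hlt : ∀ i, i < pconj p j ↔ i < r := by
      intro i
      rw [hp.lt_pconj_iff]
      constructor
      · intro h
        by_contra h'
        have := hp.1 (not_lt.1 h')
        omega
      · intro h
        have h1 := Nat.find_min hex (m := r - 1) (by omega)
        have h2 : (p (r - 1) : ℤ) - (((r - 1 : ℕ) : ℤ) + 1) ≠ x := fun h => hx ⟨_, h⟩
        have := hp.1 (show i ≤ r - 1 by omega)
        omega
    have hc : pconj p j = r := eq_of_forall_lt_iff hlt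
    exact ⟨j, by omega⟩
  · rintro ⟨j, rfl⟩ ⟨m, hm⟩
    have := hp.lt_pconj_iff m j
    dsimp only at hm
    omega

theorem mem_beads_of_lt (hp : IsPartition p) {N : ℕ} (hN : p N = 0) {x : ℤ}
    (hx : x < -(N : ℤ)) : x ∈ beads p := by
  refine ⟨(-x - 1).toNat, ?_⟩
  have := hp.1 (show N ≤ (-x - 1).toNat by omega)
  dsimp only
  omega

theorem lt_of_mem_beads (hp : IsPartition p) {x : ℤ} (hx : x ∈ beads p) : x < p 0 := by
  obtain ⟨m, rfl⟩ := hx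
  have := hp.1 (Nat.zero_le m)
  dsimp only
  omega

theorem isCore_iff (hp : IsPartition p) {n : ℕ} (hn : 0 < n) :
    IsCore n p ↔ ∀ x ∈ beads p, x - n ∈ beads p := by
  have hmem : n ∈ hooks p ↔ ∃ i j, j < p i ∧ hookLen p i j = n := by
    simp only [hooks, cells, Multiset.mem_map, Finset.mem_val, Finset.mem_filter,
      Finset.mem_product, Finset.mem_range, Prod.exists]
    constructor
    · rintro ⟨i, j, ⟨_, h⟩, rfl⟩
      exact ⟨i, j, h, rfl⟩
    · rintro ⟨i, j, h, rfl⟩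
      exact ⟨i, j, ⟨⟨(hp.lt_plen_iff i).2 (by omega), h.trans_le (hp.1 (Nat.zero_le i))⟩, h⟩, rfl⟩
  rw [IsCore, hmem]
  constructor
  · rintro h x ⟨i, rfl⟩
    by_contra hx
    obtain ⟨j, hj⟩ := (hp.not_mem_beads_iff _).1 hx
    have h1 := hp.lt_pconj_iff i j
    dsimp only at hj
    refine h ⟨i, j, by omega, ?_⟩
    unfold hookLen
    omega
  · rintro h ⟨i, j, hj, hh⟩
    have h1 := (hp.lt_pconj_iff i j).2 hj
    unfold hookLen at hh
    refine (hp.not_mem_beads_iff _).2 ⟨j, ?_⟩ (h _ ⟨i, rfl⟩)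
    dsimp only
    omega

theorem isDD_iff (hp : IsPartition p) :
    IsDD p ↔ 0 ∉ beads p ∧ ∀ k : ℤ, 0 < k → (k ∈ beads p ↔ -k ∉ beads p) := by
  have hdur : ∀ i, i < durfee p ↔ i < pconj p i := fun i => by
    rw [hp.lt_durfee_iff, hp.lt_pconj_iff]
  constructor
  · intro h
    refine ⟨?_, fun k hk => ⟨?_, fun hk' => ?_⟩⟩
    · rintro ⟨i, hi⟩
      dsimp only at hi
      have hid := (hp.lt_durfee_iff i).2 (by omega)
      have := h i hid
      have := (hdur i).1 hid
      omega
    · rintro ⟨i, hi⟩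
      dsimp only at hi
      have := h i ((hp.lt_durfee_iff i).2 (by omega))
      exact (hp.not_mem_beads_iff _).2 ⟨i, by omega⟩
    · obtain ⟨j, hj⟩ := (hp.not_mem_beads_iff _).1 hk'
      have := h j ((hdur j).2 (by omega))
      exact ⟨j, by dsimp only; omega⟩
  · rintro ⟨h0, hsymm⟩
    let f : Fin (durfee p) → ℤᵒᵈ := fun i => OrderDual.toDual ((p i : ℤ) - ((i : ℕ) + 1))
    let g : Fin (durfee p) → ℤᵒᵈ := fun i => OrderDual.toDual ((pconj p i : ℤ) - (i : ℕ))
    have hf : StrictMono f := fun a b hab => hp.strictAnti_bead hab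
    have hg : StrictMono g := by
      intro a b hab
      have hab' : (a : ℕ) < b := hab
      have hle : pconj p b ≤ pconj p a := by
        by_contra hlt
        have h1 := (hp.lt_pconj_iff (pconj p a) b).1 (by omega)
        have h2 := (hp.lt_pconj_iff (pconj p a) a).2 (by omega)
        omega
      change ((pconj p b : ℤ) - (b : ℕ)) < (pconj p a : ℤ) - (a : ℕ)
      omega
    have hrange : Set.range f = Set.range g := by
      ext x
      obtain ⟨x, rfl⟩ := OrderDual.toDual.surjective x
      simp only [Set.mem_range, f, g, EmbeddingLike.apply_eq_iff_eq]
      constructor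
      · rintro ⟨i, hi⟩
        have hid := (hp.lt_durfee_iff i).1 i.2
        have hx : x ∈ beads p := ⟨i, hi⟩
        have hx0 : x ≠ 0 := fun h => h0 (h ▸ hx)
        obtain ⟨j, hj⟩ := (hp.not_mem_beads_iff _).1 ((hsymm x (by omega)).1 hx)
        exact ⟨⟨j, (hdur j).2 (by omega)⟩, by dsimp only; omega⟩
      · rintro ⟨i, hi⟩
        have hid := (hdur i).1 i.2
        have hx : -x ∉ beads p := (hp.not_mem_beads_iff _).2 ⟨i, by omega⟩
        obtain ⟨j, hj⟩ := (hsymm x (by omega)).2 hx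
        dsimp only at hj
        exact ⟨⟨j, (hp.lt_durfee_iff j).2 (by omega)⟩, hj⟩
    intro i hi
    have := congrFun ((hf.range_inj hg).1 hrange) ⟨i, hi⟩
    simp only [f, g, EmbeddingLike.apply_eq_iff_eq] at this
    omega

theorem eq_of_beads_eq {q : ℕ → ℕ} (hp : IsPartition p) (hq : IsPartition q)
    (h : beads p = beads q) : p = q := by
  have hf := hp.strictAnti_bead.dual_right
  have hg := hq.strictAnti_bead.dual_right
  have := (hf.range_inj hg).1 (by
    rw [Set.range_comp, Set.range_comp]
    exact congrArg _ h)
  funext i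
  have := congrFun this i
  simp only [Function.comp_apply, EmbeddingLike.apply_eq_iff_eq] at this
  omega

theorem mem_beads_iff_lt_ncharge (hp : IsPartition p) {n : ℕ} (hn : 0 < n) (hc : IsCore n p)
    (k : ℤ) (r : ℕ) : k * n + r ∈ beads p ↔ k < ncharge n p r := by
  have hcore := (hp.isCore_iff hn).1 hc
  obtain ⟨N, hN⟩ := hp.2
  set S : Set ℤ := {k : ℤ | word p (k * (n : ℤ) + (r : ℤ)) = 1} with hS
  have hSmem : ∀ k, k ∈ S ↔ k * n + r ∉ beads p := fun k => word_eq_one_iff _ _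
  have hn' : (1 : ℤ) ≤ n := by exact_mod_cast hn
  have hne : S.Nonempty := ⟨p 0, (hSmem _).2 fun h => by
    have := hp.lt_of_mem_beads h
    nlinarith [Int.natCast_nonneg (p 0)]⟩
  have hbdd : BddBelow S := ⟨-(N + r + 1 : ℤ), fun k hk => by
    by_contra hlt
    refine (hSmem k).1 hk (hp.mem_beads_of_lt (hN N le_rfl) ?_)
    nlinarith⟩
  have hup : ∀ a ∈ S, a + 1 ∈ S := by
    intro a ha
    rw [hSmem] at ha ⊢
    intro h
    apply ha
    have := hcore _ h
    convert this using 1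
    ring
  have hup' : ∀ a ∈ S, ∀ b, a ≤ b → b ∈ S := fun a ha b hab =>
    Int.leInduction (motive := fun b _ => b ∈ S) ha (fun b _ hb => hup b hb) b hab
  have hmem : ncharge n p r ∈ S := Int.csInf_mem hne hbdd
  rw [← not_iff_not, not_lt, ← hSmem]
  exact ⟨fun h => csInf_le hbdd h, fun h => hup' _ hmem _ h⟩

end IsPartition

theorem ncharge_eq_of_beads {n : ℕ} {p : ℕ → ℕ} {r : ℕ} {m : ℤ}
    (h : ∀ k : ℤ, k * n + r ∈ beads p ↔ k < m) : ncharge n p r = m := by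
  have : {k : ℤ | word p (k * (n : ℤ) + (r : ℤ)) = 1} = Set.Ici m := by
    ext k
    simp [word_eq_one_iff, h]
  rw [ncharge, this, csInf_Ici]

theorem exists_eq_mul_add {n : ℕ} (hn : 0 < n) (x : ℤ) :
    ∃ k : ℤ, ∃ r < n, x = k * n + (r : ℕ) := by
  have hn' : (0 : ℤ) < n := by exact_mod_cast hn
  have h1 := Int.emod_nonneg x hn'.ne'
  have h2 := Int.emod_lt_of_pos x hn'
  refine ⟨x / n, (x % n).toNat, by omega, ?_⟩
  rw [Int.toNat_of_nonneg h1]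
  exact (Int.ediv_mul_add_emod x n).symm

/-- Summation over a truncated abacus, runner by runner. -/
theorem sum_abacus {n M : ℕ} (hn : 0 < n) {m : ℕ → ℤ} {S : Finset ℤ}
    (hS : ∀ k : ℤ, ∀ r < n, k * n + r ∈ S ↔ -(M : ℤ) ≤ k ∧ k < m r) (f : ℤ → ℤ) :
    ∑ x ∈ S, f x = ∑ r ∈ Finset.range n, ∑ k ∈ Finset.Ico (-(M : ℤ)) (m r), f (k * n + r) := by
  rw [Finset.sum_sigma']
  symm
  refine Finset.sum_nbij (fun a => a.2 * n + a.1) ?_ ?_ ?_ fun _ _ => rfl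
  · rintro ⟨r, k⟩ h
    simp only [Finset.mem_sigma, Finset.mem_range, Finset.mem_Ico] at h
    exact (hS k r h.1).2 h.2
  · rintro ⟨r, k⟩ h ⟨r', k'⟩ h' heq
    simp only [Finset.coe_sigma, Set.mem_sigma_iff, Finset.coe_range, Set.mem_Iio] at h h'
    dsimp only at heq
    have hn' : (0 : ℤ) < n := by exact_mod_cast hn
    have h1 : k = k' := by
      have hr : (r : ℤ) < n := by exact_mod_cast h.1
      have hr' : (r' : ℤ) < n := by exact_mod_cast h'.1
      rcases lt_trichotomy k k' with hlt | heq' | hgt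
      · nlinarith
      · exact heq'
      · nlinarith
    subst h1
    have h2 : r = r' := by omega
    subst h2
    rfl
  · intro x hx
    obtain ⟨k, r, hr, rfl⟩ := exists_eq_mul_add hn x
    exact ⟨⟨r, k⟩, by simpa [hr] using (hS k r hr).1 hx, rfl⟩

theorem two_mul_sum_Ico_int {a b : ℤ} (hab : a ≤ b) :
    2 * ∑ k ∈ Finset.Ico a b, k = b * (b - 1) - a * (a - 1) := by
  induction b, hab using Int.leInduction with
  | base => simp
  | succ b hb ih =>
    rw [← Finset.insert_Ico_right_eq_Ico_add_one hb, Finset.sum_insert (by simp), mul_add, ih]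
    ring

theorem sum_beads_range {p : ℕ → ℕ} (hp : IsPartition p) {n : ℕ} (hn : 0 < n) (hc : IsCore n p)
    {M : ℕ} (hM : p (n * M) = 0) (f : ℤ → ℤ) :
    (∀ r < n, -(M : ℤ) ≤ ncharge n p r) ∧
    ∑ i ∈ Finset.range (n * M), f ((p i : ℤ) - ((i : ℤ) + 1)) =
      ∑ r ∈ Finset.range n, ∑ k ∈ Finset.Ico (-(M : ℤ)) (ncharge n p r), f (k * n + r) := by
  constructor
  · intro r hr
    have := (hp.mem_beads_iff_lt_ncharge hn hc (-(M : ℤ) - 1) r).1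
      (hp.mem_beads_of_lt hM (by push_cast; nlinarith))
    omega
  rw [← sum_abacus hn (S := (Finset.range (n * M)).image fun i : ℕ => (p i : ℤ) - ((i : ℤ) + 1)),
    Finset.sum_image fun a _ b _ h => hp.strictAnti_bead.injective h]
  intro k r hr
  rw [← hp.mem_beads_iff_lt_ncharge hn hc]
  have hbound : -(M : ℤ) ≤ k ↔ -((n * M : ℕ) : ℤ) ≤ k * n + r := by
    have hn' : (0 : ℤ) < n := by exact_mod_cast hn
    have hr' : (r : ℤ) < n := by exact_mod_cast hr
    push_cast
    constructor
    · intro h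
      nlinarith
    · intro h
      by_contra hlt
      nlinarith
  rw [hbound]
  generalize n * M = N at *
  simp only [Finset.mem_image, Finset.mem_range, beads, Set.mem_range]
  constructor
  · rintro ⟨i, hi, h⟩
    exact ⟨by omega, i, h⟩
  · rintro ⟨hk, i, h⟩
    refine ⟨i, ?_, h⟩
    by_contra hlt
    have := hp.1 (not_lt.1 hlt)
    omega

theorem exists_mul_eq_zero {p : ℕ → ℕ} (hp : IsPartition p) {n : ℕ} (hn : 0 < n) :
    ∃ M, ∀ i, n * M ≤ i → p i = 0 := by
  obtain ⟨N, hN⟩ := hp.2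
  exact ⟨N, fun i hi => hN i ((Nat.le_mul_of_pos_left N hn).trans hi)⟩

theorem sum_ncharge {p : ℕ → ℕ} (hp : IsPartition p) {n : ℕ} (hn : 0 < n) (hc : IsCore n p) :
    ∑ r ∈ Finset.range n, ncharge n p r = 0 := by
  obtain ⟨M, hM⟩ := exists_mul_eq_zero hp hn
  obtain ⟨h1, h2⟩ := sum_beads_range hp hn hc (hM _ le_rfl) fun _ => 1
  have h3 : ∀ r ∈ Finset.range n, ∑ k ∈ Finset.Ico (-(M : ℤ)) (ncharge n p r), (1 : ℤ) =
      ncharge n p r + M := by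
    intro r hr
    have := h1 r (Finset.mem_range.1 hr)
    simp
    omega
  rw [Finset.sum_congr rfl h3, Finset.sum_add_distrib] at h2
  simp at h2
  linarith

theorem two_mul_psize {p : ℕ → ℕ} (hp : IsPartition p) {n : ℕ} (hn : 0 < n) (hc : IsCore n p) :
    2 * (psize p : ℤ) = ∑ r ∈ Finset.range n,
      (n * ncharge n p r ^ 2 + 2 * (r * ncharge n p r)) := by
  obtain ⟨M, hM⟩ := exists_mul_eq_zero hp hn
  obtain ⟨h1, h2⟩ := sum_beads_range hp hn hc (hM _ le_rfl) fun x => x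
  have hsize : psize p = ∑ i ∈ Finset.range (n * M), p i := by
    refine Finset.sum_subset (fun i hi => ?_) fun i _ hi => ?_
    · rw [Finset.mem_range, hp.lt_plen_iff] at hi
      by_contra h
      exact hi (hM i (by simpa using h))
    · rw [Finset.mem_range, hp.lt_plen_iff] at hi
      exact not_not.1 hi
  have hgauss : ∀ a : ℕ, ∑ i ∈ Finset.range a, (2 * (i : ℤ)) = a * (a - 1) := by
    intro a
    induction a with
    | zero => simp
    | succ a ih => rw [Finset.sum_range_succ, ih]; push_cast; ring
  have h3 : ∀ r ∈ Finset.range n,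
      2 * ∑ k ∈ Finset.Ico (-(M : ℤ)) (ncharge n p r), (k * n + r : ℤ) =
      (n * ncharge n p r ^ 2 + 2 * (r * ncharge n p r)) - n * ncharge n p r
        - n * M * (M + 1) + M * (2 * r) := by
    intro r hr
    have h4 := h1 r (Finset.mem_range.1 hr)
    have h5 := two_mul_sum_Ico_int h4
    rw [Finset.sum_add_distrib, ← Finset.sum_mul, mul_add, ← mul_assoc, h5, Finset.sum_const,
      Int.card_Ico, nsmul_eq_mul, Int.toNat_of_nonneg (by omega)]
    ring
  have h6 := congrArg (2 * ·) h2
  simp only [Finset.mul_sum (Finset.range n)] at h6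
  rw [Finset.sum_congr rfl h3, Finset.sum_add_distrib, Finset.sum_sub_distrib,
    Finset.sum_sub_distrib, Finset.sum_sub_distrib, ← Finset.mul_sum _ _ (n : ℤ),
    ← Finset.mul_sum _ _ (M : ℤ), hgauss, sum_ncharge hp hn hc,
    Finset.sum_add_distrib (f := fun i : ℕ => (i : ℤ))] at h6
  have h7 := hgauss (n * M)
  rw [← Finset.mul_sum] at h7
  simp only [Finset.sum_const, Finset.card_range, nsmul_eq_mul] at h6
  rw [hsize]
  push_cast at h6 h7 ⊢
  linear_combination h6 + h7

theorem sum_range_fold (n : ℕ) (hn : 2 ≤ n) (f : ℕ → ℤ) :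
    ∑ r ∈ Finset.range n, f r = f 0
      + ∑ i ∈ Finset.range ((n - 1) / 2), (f (i + 1) + f (n - (i + 1)))
      + if 2 * (n / 2) = n then f (n / 2) else 0 := by
  have hsplit : ∀ h a : ℕ, ∑ i ∈ Finset.range h, f (a + i) =
      ∑ i ∈ Finset.range h, f (a + h - (i + 1)) := by
    intro h a
    rw [← Finset.sum_range_reflect]
    refine Finset.sum_congr rfl fun i hi => ?_
    have := Finset.mem_range.1 hi
    congr 1
    omega
  set h := (n - 1) / 2 with hh
  rw [Finset.sum_add_distrib]
  rcases Nat.even_or_odd' n with ⟨c, hc | hc⟩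
  · have h1 : n = (1 + h) + 1 + h := by omega
    have h2 : n / 2 = 1 + h := by omega
    rw [if_pos (by omega), h2]
    have h3 := hsplit h (1 + h + 1)
    rw [← h1] at h3
    rw [← h3]
    conv_lhs => rw [h1]
    rw [Finset.sum_range_add, Finset.sum_range_succ, add_comm 1 h, Finset.sum_range_succ']
    ring
  · have h1 : n = (h + 1) + h := by omega
    rw [if_neg (by omega)]
    have h3 := hsplit h (h + 1)
    rw [← h1] at h3
    rw [← h3]
    conv_lhs => rw [h1]
    rw [Finset.sum_range_add, Finset.sum_range_succ']
    ring

/-- A balanced, truncated set of positions is the bead set of a partition. -/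
theorem exists_partition_of_beads {B : Set ℤ} {N : ℕ} (hhi : ∀ x ∈ B, x < N)
    (hlo : ∀ x, x < -(N : ℤ) → x ∈ B)
    (hcard : ((Finset.Ico (-(N : ℤ)) N).filter (· ∈ B)).card = N) :
    ∃ p, IsPartition p ∧ beads p = B := by
  set Q : ℕ → Prop := fun t => (N : ℤ) - 1 - t ∈ B with hQ
  have hQlo : ∀ t, 2 * N ≤ t → Q t := fun t ht => hlo _ (by omega)
  have hinf : (Set.ofPred Q).Infinite := by
    refine Set.infinite_of_forall_exists_gt fun a => ⟨a + 2 * N + 1, hQlo _ (by omega), by omega⟩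
  have hcount : Nat.count Q (2 * N) = N := by
    rw [Nat.count_eq_card_filter_range]
    refine Eq.trans ?_ hcard
    refine Finset.card_nbij' (fun t => (N : ℤ) - 1 - t) (fun x => ((N : ℤ) - 1 - x).toNat) ?_ ?_ ?_ ?_
    · intro t ht
      simp only [Finset.coe_filter, Finset.mem_range, Set.mem_ofPred_eq, Finset.mem_Ico] at ht ⊢
      exact ⟨by omega, ht.2⟩
    · intro x hx
      simp only [Finset.coe_filter, Finset.mem_range, Set.mem_ofPred_eq, Finset.mem_Ico, hQ] at hx ⊢
      refine ⟨by omega, ?_⟩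
      rw [Int.toNat_of_nonneg (by omega)]
      convert hx.2 using 1
      ring
    · intro t ht
      dsimp only
      omega
    · intro x hx
      simp only [Finset.coe_filter, Set.mem_ofPred_eq, Finset.mem_Ico] at hx
      dsimp only
      omega
  have hcount' : ∀ d, Nat.count Q (2 * N + d) = N + d := by
    intro d
    induction d with
    | zero => exact hcount
    | succ d ih => rw [← add_assoc, Nat.count_succ, ih, if_pos (hQlo _ (by omega)), add_assoc]
  have hnth : ∀ i, N ≤ i → Nat.nth Q i = N + i := by
    intro i hi
    have := Nat.nth_count (hQlo (2 * N + (i - N)) (by omega))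
    rw [hcount'] at this
    rw [show N + (i - N) = i by omega] at this
    omega
  have hmono : StrictMono (Nat.nth Q) := Nat.nth_strictMono hinf
  have hshift : ∀ i j, i ≤ j → Nat.nth Q i + j ≤ Nat.nth Q j + i := by
    intro i j hij
    induction j, hij using Nat.le_induction with
    | base => exact le_rfl
    | succ j _ ih =>
      have := hmono (Nat.lt_succ_self j)
      simp only [Nat.succ_eq_add_one] at this
      omega
  have hle : ∀ i, Nat.nth Q i ≤ N + i := by
    intro i
    have h1 := hshift i (i + N) (by omega)
    have h2 := hnth (i + N) (by omega)
    omega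
  refine ⟨fun i => N + i - Nat.nth Q i, ⟨fun i j hij => ?_, N, fun i hi => ?_⟩, ?_⟩
  · have := hshift i j hij
    dsimp only
    omega
  · have := hnth i hi
    dsimp only
    omega
  · ext x
    simp only [beads, Set.mem_range]
    constructor
    · rintro ⟨i, rfl⟩
      have h1 : Q (Nat.nth Q i) := Nat.nth_mem_of_infinite hinf i
      have h2 := hle i
      convert h1 using 1
      omega
    · intro hx
      have hlt := hhi x hx
      have hQx : Q ((N : ℤ) - 1 - x).toNat := by
        simp only [hQ]
        rw [Int.toNat_of_nonneg (by omega)]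
        convert hx using 1
        ring
      refine ⟨Nat.count Q ((N : ℤ) - 1 - x).toNat, ?_⟩
      have h2 := hle (Nat.count Q ((N : ℤ) - 1 - x).toNat)
      rw [Nat.nth_count hQx] at h2 ⊢
      omega

theorem exists_core_of_charge {n : ℕ} (hn : 0 < n) (m : ℕ → ℤ)
    (hm : ∑ r ∈ Finset.range n, m r = 0) :
    ∃ p, IsPartition p ∧ IsCore n p ∧ ∀ r < n, ncharge n p r = m r := by
  have hn' : (0 : ℤ) < n := by exact_mod_cast hn
  set B : Set ℤ := {x | x / n < m (x % n).toNat} with hB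
  have hBmem : ∀ k : ℤ, ∀ r < n, k * n + r ∈ B ↔ k < m r := by
    intro k r hr
    have hr' : (r : ℤ) < n := by exact_mod_cast hr
    have h1 : (k * n + r) / (n : ℤ) = k := by
      rw [add_comm, Int.add_mul_ediv_right _ _ hn'.ne',
        Int.ediv_eq_zero_of_lt (Int.natCast_nonneg r) hr', zero_add]
    have h2 : ((k * n + r) % (n : ℤ)).toNat = r := by
      rw [add_comm, Int.add_mul_emod_self_right, Int.emod_eq_of_lt (Int.natCast_nonneg r) hr']
      simp
    simp only [hB, Set.mem_ofPred_eq, h1, h2]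
  set M : ℕ := ∑ r ∈ Finset.range n, (m r).natAbs with hM
  have hMle : ∀ r < n, (m r).natAbs ≤ M := fun r hr =>
    Finset.single_le_sum (f := fun r => (m r).natAbs) (fun _ _ => Nat.zero_le _)
      (Finset.mem_range.2 hr)
  have hcmp : ∀ k : ℤ, ∀ r < n, ∀ a : ℤ, a * n ≤ k * n + (r : ℕ) ↔ a ≤ k := by
    intro k r hr a
    have hr' : (r : ℤ) < n := by exact_mod_cast hr
    constructor
    · intro h
      by_contra hlt
      nlinarith
    · intro h
      nlinarith
  have hN : ((n * M : ℕ) : ℤ) = (M : ℤ) * n := by push_cast; ring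
  have hN' : -((n * M : ℕ) : ℤ) = (-(M : ℤ)) * n := by push_cast; ring
  have hhi : ∀ x ∈ B, x < ((n * M : ℕ) : ℤ) := by
    intro x hx
    obtain ⟨k, r, hr, rfl⟩ := exists_eq_mul_add hn x
    rw [hBmem k r hr] at hx
    rw [← not_le, hN, hcmp k r hr]
    have := hMle r hr
    omega
  have hlo : ∀ x, x < -((n * M : ℕ) : ℤ) → x ∈ B := by
    intro x hx
    obtain ⟨k, r, hr, rfl⟩ := exists_eq_mul_add hn x
    rw [← not_le, hN', hcmp k r hr] at hx
    rw [hBmem k r hr]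
    have := hMle r hr
    omega
  have hcard : ((Finset.Ico (-((n * M : ℕ) : ℤ)) (n * M : ℕ)).filter (· ∈ B)).card = n * M := by
    have h1 := sum_abacus hn (M := M) (m := m)
      (S := (Finset.Ico (-((n * M : ℕ) : ℤ)) (n * M : ℕ)).filter (· ∈ B)) (by
        intro k r hr
        rw [Finset.mem_filter, Finset.mem_Ico, ← hBmem k r hr, hN', hcmp k r hr]
        exact ⟨fun h => ⟨h.1.1, h.2⟩, fun h => ⟨⟨h.1, hhi _ h.2⟩, h.2⟩⟩) fun _ => 1
    have h3 : ∀ r ∈ Finset.range n, ∑ k ∈ Finset.Ico (-(M : ℤ)) (m r), (1 : ℤ) = m r + M := by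
      intro r hr
      have := hMle r (Finset.mem_range.1 hr)
      simp
      omega
    rw [Finset.sum_congr rfl h3, Finset.sum_add_distrib, hm] at h1
    simp only [Finset.sum_const, Finset.card_range, nsmul_eq_mul, mul_one, zero_add] at h1
    exact_mod_cast h1
  obtain ⟨p, hp, hpB⟩ := exists_partition_of_beads hhi hlo (by convert hcard)
  refine ⟨p, hp, (hp.isCore_iff hn).2 fun x hx => ?_, fun r hr =>
    ncharge_eq_of_beads fun k => by rw [hpB, hBmem k r hr]⟩
  rw [hpB] at hx ⊢
  obtain ⟨k, r, hr, rfl⟩ := exists_eq_mul_add hn x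
  rw [hBmem k r hr] at hx
  rw [show k * n + (r : ℤ) - n = (k - 1) * n + r by ring, hBmem _ r hr]
  omega

theorem isDD_iff_ncharge {p : ℕ → ℕ} (hp : IsPartition p) {n : ℕ} (hn : 0 < n)
    (hc : IsCore n p) :
    IsDD p ↔ ncharge n p 0 = 0 ∧
      ∀ i, 1 ≤ i → i < n → ncharge n p (n - i) = - ncharge n p i := by
  have hn' : (0 : ℤ) < n := by exact_mod_cast hn
  have hmem := hp.mem_beads_iff_lt_ncharge hn hc
  have hneg : ∀ k : ℤ, ∀ i ≤ n, -(k * n + (i : ℕ)) ∈ beads p ↔ -k - 1 < ncharge n p (n - i) := by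
    intro k i hi
    rw [← hmem]
    push_cast [hi]
    ring_nf
  rw [hp.isDD_iff]
  constructor
  · rintro ⟨h0, hs⟩
    have hs' : ∀ x : ℤ, x ≠ 0 → (x ∈ beads p ↔ -x ∉ beads p) := by
      intro x hx
      rcases lt_or_gt_of_ne hx with h | h
      · have := hs (-x) (by omega)
        rw [neg_neg] at this
        tauto
      · exact hs x h
    constructor
    · have h1 : ¬ (0 : ℤ) < ncharge n p 0 := by
        rw [← hmem]
        simpa using h0
      have h2 : (-1 : ℤ) < ncharge n p 0 := by
        rw [← hmem, hs' _ (by push_cast; omega)]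
        have := hmem 1 0
        simp only [Nat.cast_zero, add_zero, one_mul, neg_mul, neg_neg] at this ⊢
        rw [this]
        omega
      omega
    · intro i hi hin
      have hne : ∀ k : ℤ, k * n + (i : ℕ) ≠ 0 := by
        intro k hk
        have h1 : (n : ℤ) ∣ i := ⟨-k, by linarith⟩
        have := Nat.le_of_dvd (by omega) (Int.natCast_dvd_natCast.1 h1)
        omega
      have h1 : ∀ k : ℤ, k < ncharge n p i ↔ ¬ (-k - 1 < ncharge n p (n - i)) := by
        intro k
        rw [← hmem, ← hneg k i hin.le]
        exact hs' _ (hne k)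
      have h2 := h1 (ncharge n p i)
      have h3 := h1 (ncharge n p i - 1)
      omega
  · rintro ⟨h0, hs⟩
    refine ⟨fun h => ?_, fun x hx => ?_⟩
    · have := (hmem 0 0).1 (by simpa using h)
      omega
    · obtain ⟨k, r, hr, rfl⟩ := exists_eq_mul_add hn x
      rcases Nat.eq_zero_or_pos r with rfl | hr0
      · have hk : 0 < k := by
          simp only [Nat.cast_zero, add_zero] at hx
          exact pos_of_mul_pos_left hx hn'.le
        have h3 := hmem (-k) 0
        rw [hmem, h0]
        simp only [Nat.cast_zero, add_zero, neg_mul] at h3 ⊢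
        rw [h3, h0]
        omega
      · rw [hmem, hneg k r hr.le, hs r hr0 hr]
        omega

/-- For an antisymmetric charge of total zero, the middle entry vanishes, so that the
antisymmetry propagates from the first half to all the indices. -/
theorem antisymm_of_half {n : ℕ} (hn : 2 ≤ n) {m : ℕ → ℤ}
    (hsum : ∑ r ∈ Finset.range n, m r = 0) (h0 : m 0 = 0)
    (h : ∀ i, 1 ≤ i → i ≤ (n - 1) / 2 → m (n - i) = - m i) :
    ∀ i, 1 ≤ i → i < n → m (n - i) = - m i := by
  intro i hi hin
  rcases lt_trichotomy (2 * i) n with hlt | heq | hgt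
  · exact h i hi (by omega)
  · rw [sum_range_fold n hn, h0, if_pos (by omega), Finset.sum_eq_zero, show n / 2 = i by omega]
      at hsum
    · rw [show n - i = i by omega]
      omega
    · intro j hj
      have := Finset.mem_range.1 hj
      rw [h (j + 1) (by omega) (by omega)]
      ring
  · have := h (n - i) (by omega) (by omega)
    rw [show n - (n - i) = i by omega] at this
    omega

theorem isDD_iff_ncharge_half {p : ℕ → ℕ} (hp : IsPartition p) {n : ℕ} (hn : 2 ≤ n)
    (hc : IsCore n p) :
    IsDD p ↔ ncharge n p 0 = 0 ∧
      ∀ i, 1 ≤ i → i ≤ (n - 1) / 2 → ncharge n p (n - i) = - ncharge n p i := by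
  rw [isDD_iff_ncharge hp (by omega) hc]
  refine and_congr_right fun h0 => ⟨fun h i hi hin => h i hi (by omega), fun h => ?_⟩
  exact antisymm_of_half hn (sum_ncharge hp (by omega) hc) h0 h

theorem beads_eq_of_ncharge_eq {p q : ℕ → ℕ} (hp : IsPartition p) (hq : IsPartition q) {n : ℕ}
    (hn : 0 < n) (hcp : IsCore n p) (hcq : IsCore n q)
    (h : ∀ r < n, ncharge n p r = ncharge n q r) : beads p = beads q := by
  ext x
  obtain ⟨k, r, hr, rfl⟩ := exists_eq_mul_add hn x
  rw [hp.mem_beads_iff_lt_ncharge hn hcp, hq.mem_beads_iff_lt_ncharge hn hcq, h r hr]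

theorem bijective_ncharge_dd (n : ℕ) (hn : 2 ≤ n) :
    Function.Bijective
      (fun ω : {w : ℕ → ℕ // IsPartition w ∧ IsCore n w ∧ IsDD w} =>
        fun i : Fin ((n - 1) / 2) => ncharge n ω.1 ((i : ℕ) + 1)) := by
  constructor
  · rintro ⟨p, hp, hcp, hdp⟩ ⟨q, hq, hcq, hdq⟩ h
    obtain ⟨hp0, hps⟩ := (isDD_iff_ncharge hp (by omega) hcp).1 hdp
    obtain ⟨hq0, hqs⟩ := (isDD_iff_ncharge hq (by omega) hcq).1 hdq
    have hhalf : ∀ i, 1 ≤ i → i ≤ (n - 1) / 2 → ncharge n p i = ncharge n q i := by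
      intro i hi hin
      have := congrFun h ⟨i - 1, by omega⟩
      simpa [Nat.sub_add_cancel hi] using this
    refine Subtype.ext (show p = q from hp.eq_of_beads_eq hq
      (beads_eq_of_ncharge_eq hp hq (by omega) hcp hcq fun r hr => ?_))
    rcases Nat.eq_zero_or_pos r with rfl | hr0
    · rw [hp0, hq0]
    have h1 := hps r hr0 hr
    have h2 := hqs r hr0 hr
    rcases lt_trichotomy (2 * r) n with hlt | heq | hgt
    · exact hhalf r hr0 (by omega)
    · rw [show n - r = r by omega] at h1 h2
      omega
    · have := hhalf (n - r) (by omega) (by omega)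
      omega
  · intro v
    let u : ℕ → ℤ := fun i => if h : i < (n - 1) / 2 then v ⟨i, h⟩ else 0
    let m : ℕ → ℤ := fun r =>
      if r = 0 then 0 else if 2 * r < n then u (r - 1) else if 2 * r = n then 0
      else -u (n - r - 1)
    have hm0 : m 0 = 0 := by simp [m]
    have hm1 : ∀ i, 1 ≤ i → i ≤ (n - 1) / 2 → m i = u (i - 1) := by
      intro i hi hin
      simp only [m]
      rw [if_neg (by omega), if_pos (by omega)]
    have hm2 : ∀ i, 1 ≤ i → i ≤ (n - 1) / 2 → m (n - i) = - m i := by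
      intro i hi hin
      rw [hm1 i hi hin]
      simp only [m]
      rw [if_neg (by omega), if_neg (by omega), if_neg (by omega), show n - (n - i) = i by omega]
    have hsum : ∑ r ∈ Finset.range n, m r = 0 := by
      rw [sum_range_fold n hn, hm0, Finset.sum_eq_zero]
      · split_ifs with h
        · simp only [m]
          rw [if_neg (by omega), if_neg (by omega), if_pos (by omega)]
          rfl
        · rfl
      · intro j hj
        have := Finset.mem_range.1 hj
        rw [hm2 (j + 1) (by omega) (by omega)]
        ring
    obtain ⟨p, hp, hcp, hpm⟩ := exists_core_of_charge (by omega) m hsum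
    refine ⟨⟨p, hp, hcp, (isDD_iff_ncharge_half hp hn hcp).2 ⟨?_, fun i hi hin => ?_⟩⟩, ?_⟩
    · rw [hpm 0 (by omega), hm0]
    · rw [hpm _ (by omega), hpm _ (by omega), hm2 i hi hin]
    · funext i
      have hi := i.2
      dsimp only
      rw [hpm _ (by omega), hm1 _ (by omega) (by omega)]
      simp [u]

theorem psize_of_isDD {p : ℕ → ℕ} (hp : IsPartition p) {n : ℕ} (hn : 2 ≤ n) (hc : IsCore n p)
    (hd : IsDD p) :
    (psize p : ℤ) =
      (n : ℤ) * ∑ i ∈ Finset.range ((n - 1) / 2), (ncharge n p (i + 1)) ^ 2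
        + ∑ i ∈ Finset.range ((n - 1) / 2),
            (2 * ((i : ℤ) + 1) - (n : ℤ)) * ncharge n p (i + 1) := by
  obtain ⟨h0, hs⟩ := (isDD_iff_ncharge hp (by omega) hc).1 hd
  have hsize := two_mul_psize hp (by omega) hc
  have hmid : 2 * (n / 2) = n → ncharge n p (n / 2) = 0 := by
    intro h
    have := hs (n / 2) (by omega) (by omega)
    rw [show n - n / 2 = n / 2 by omega] at this
    omega
  rw [sum_range_fold n hn, h0] at hsize
  have hlast : (if 2 * (n / 2) = n then (n : ℤ) * ncharge n p (n / 2) ^ 2 +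
      2 * ((n / 2 : ℕ) * ncharge n p (n / 2)) else 0) = 0 := by
    split_ifs with h
    · rw [hmid h]
      ring
    · rfl
  rw [hlast] at hsize
  have hterm : ∀ i ∈ Finset.range ((n - 1) / 2),
      ((n : ℤ) * ncharge n p (i + 1) ^ 2 + 2 * ((i + 1 : ℕ) * ncharge n p (i + 1)) +
        (n * ncharge n p (n - (i + 1)) ^ 2 +
          2 * ((n - (i + 1) : ℕ) * ncharge n p (n - (i + 1))))) =
      2 * (n * ncharge n p (i + 1) ^ 2 + (2 * ((i : ℤ) + 1) - n) * ncharge n p (i + 1)) := by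
    intro i hi
    have := Finset.mem_range.1 hi
    rw [hs (i + 1) (by omega) (by omega), Nat.cast_sub (by omega)]
    push_cast
    ring
  rw [Finset.sum_congr rfl hterm, ← Finset.mul_sum, Finset.sum_add_distrib, ← Finset.mul_sum]
    at hsize
  linarith

/-- Let `ω` be an `n`-core with `n`-charge `φ_n(ω) = (m_0, …, m_{n-1})`.  Then `ω`
is a doubled distinct `n`-core iff `m_0 = 0` and `m_{n-i} = -m_i` for all
`i ∈ {1, …, ⌊(n-1)/2⌋}`; the map sending a doubled distinct `n`-core `ω` to
`(m_1, …, m_{⌊(n-1)/2⌋})` is a bijection onto `ℤ^{⌊(n-1)/2⌋}`; and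
`|ω| = n ∑_{i=1}^{⌊(n-1)/2⌋} m_i² + ∑_{i=1}^{⌊(n-1)/2⌋} (2i - n) m_i`. -/
theorem doubled_distinct_core_charge (n : ℕ) (hn : 2 ≤ n) :
    (∀ ω : ℕ → ℕ, IsPartition ω → IsCore n ω →
      (IsDD ω ↔
        (ncharge n ω 0 = 0 ∧
          ∀ i, 1 ≤ i → i ≤ (n - 1) / 2 → ncharge n ω (n - i) = - ncharge n ω i))) ∧
    Function.Bijective
      (fun ω : {w : ℕ → ℕ // IsPartition w ∧ IsCore n w ∧ IsDD w} =>
        fun i : Fin ((n - 1) / 2) => ncharge n ω.1 ((i : ℕ) + 1)) ∧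
    (∀ ω : ℕ → ℕ, IsPartition ω → IsCore n ω → IsDD ω →
      (psize ω : ℤ) =
        (n : ℤ) * ∑ i ∈ Finset.range ((n - 1) / 2), (ncharge n ω (i + 1)) ^ 2
          + ∑ i ∈ Finset.range ((n - 1) / 2),
              (2 * ((i : ℤ) + 1) - (n : ℤ)) * ncharge n ω (i + 1)) := by
  exact ⟨fun _ hp hc => isDD_iff_ncharge_half hp hn hc, bijective_ncharge_dd n hn,
    fun _ hp hc hd => psize_of_isDD hp hn hc hd⟩
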